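/- For each h ≥ 1 define f_h on the 3h+1 variables x_1^{(1)},x_2^{(1)},…,x_1^{(h)},x_2^{(h)}, y^{(1)},…,y^{(h)}, z by: f_0(z) = +1 if z = 1 and −1 if z = 0; and f_h(x,y,z) = (+1 if y^{(h)} = 1 else −1) when x_1^{(h)} ∨ x_2^{(h)} holds, and f_h(x,y,z) = f_{h−1}(x,y,z) otherwise. Then the optimal decision tree size of f_h is at most 4h + 2, yet BuildTopDownDT(f_h, 0) — regardless of how ties are broken — outputs a tree of size at least 2^{h+1}. Consequently there are functions with optimal size s = Θ(n) for which TopDownDTSize(f) ≥ 2^{Ω(s)}. -/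

import Mathlib

/- Common definitions: decision trees, bare trees, influence, and the
   BuildTopDownDT top-down heuristic (modelled as a nondeterministic step
   relation, so that all tie-breakings are covered). -/

noncomputable section

namespace TopDownDT

/-- Influence of variable `i` on a Boolean function over a finite index set
(`true` codes +1, `false` codes −1). -/
def influence {I : Type} [Fintype I] [DecidableEq I]
    (f : (I → Bool) → Bool) (i : I) : ℝ :=
  ((Finset.univ.filter fun x : I → Bool =>
      f x ≠ f (Function.update x i (!x i))).card : ℝ) / 2 ^ Fintype.card I

/-- Total influence. -/
def totalInfluence {I : Type} [Fintype I] [DecidableEq I]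
    (f : (I → Bool) → Bool) : ℝ :=
  ∑ i : I, influence f i

variable {n : ℕ}

/-- Override inputs according to a partial assignment (earlier entries take precedence). -/
def override (π : List (Fin n × Bool)) (x : Fin n → Bool) : Fin n → Bool :=
  fun i =>
    match π.find? (fun p => decide (p.1 = i)) with
    | some p => p.2
    | none => x i

/-- Restriction of `f` by the partial assignment `π` (as a function on the whole cube;
the fixed coordinates become irrelevant). -/
def restrictList (f : (Fin n → Bool) → Bool) (π : List (Fin n × Bool)) :
    (Fin n → Bool) → Bool :=
  fun x => f (override π x)

/-- Decision trees with ±1 leaves (`true` codes +1, `false` codes −1). -/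
inductive DecTree (n : ℕ) : Type
  | leaf : Bool → DecTree n
  | node : Fin n → DecTree n → DecTree n → DecTree n
  deriving DecidableEq

/-- Evaluation of a decision tree. -/
def DecTree.eval : DecTree n → (Fin n → Bool) → Bool
  | .leaf b, _ => b
  | .node i t0 t1, x => if x i then t1.eval x else t0.eval x

/-- Size (number of leaves) of a decision tree. -/
def DecTree.size : DecTree n → ℕ
  | .leaf _ => 1
  | .node _ t0 t1 => t0.size + t1.size

/-- Depth of a decision tree. -/
def DecTree.depth : DecTree n → ℕ
  | .leaf _ => 0
  | .node _ t0 t1 => max t0.depth t1.depth + 1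

/-- Number of queries the tree makes on input `x` (the depth of the leaf reached by `x`). -/
def DecTree.pathLen : DecTree n → (Fin n → Bool) → ℕ
  | .leaf _, _ => 0
  | .node i t0 t1, x => (if x i then t1.pathLen x else t0.pathLen x) + 1

/-- The optimal decision tree size of `f`: the least size of a decision tree computing `f`. -/
def optSize (f : (Fin n → Bool) → Bool) : ℕ :=
  sInf {s : ℕ | ∃ T : DecTree n, (∀ x, T.eval x = f x) ∧ T.size = s}

/-- Bare trees: decision trees with unlabeled leaves. -/
inductive BareTree (n : ℕ) : Type
  | leaf : BareTree n
  | node : Fin n → BareTree n → BareTree n → BareTree n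
  deriving DecidableEq

/-- Size (number of leaves) of a bare tree. -/
def BareTree.size : BareTree n → ℕ
  | .leaf => 1
  | .node _ t0 t1 => t0.size + t1.size

/-- Root-to-leaf paths of a bare tree, recorded as lists of (variable, value) pairs. -/
def BareTree.leafPaths : BareTree n → List (List (Fin n × Bool))
  | .leaf => [[]]
  | .node i t0 t1 =>
      (t0.leafPaths.map fun p => (i, false) :: p) ++
      (t1.leafPaths.map fun p => (i, true) :: p)

/-- Replace the leaf at the end of the path `π` by the bare tree `t`. -/
def BareTree.replaceLeaf : BareTree n → List (Fin n × Bool) → BareTree n → BareTree n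
  | .leaf, [], t => t
  | .leaf, _ :: _, _ => .leaf
  | .node i t0 t1, [], _ => .node i t0 t1
  | .node i t0 t1, p :: ps, t =>
      if p.2 then .node i t0 (t1.replaceLeaf ps t)
      else .node i (t0.replaceLeaf ps t) t1

/-- The `f`-completion: label each leaf `ℓ` by the sign of `E[f_ℓ]`. -/
def completionAux (f : (Fin n → Bool) → Bool) :
    BareTree n → List (Fin n × Bool) → DecTree n
  | .leaf, π =>
      .leaf (decide (2 ^ n ≤ 2 * (Finset.univ.filter fun x => restrictList f π x = true).card))
  | .node i t0 t1, π =>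
      .node i (completionAux f t0 (π ++ [(i, false)]))
              (completionAux f t1 (π ++ [(i, true)]))

/-- The `f`-completion of a bare tree. -/
def completion (f : (Fin n → Bool) → Bool) (T : BareTree n) : DecTree n :=
  completionAux f T []

/-- Fraction of points of the cube on which `f` and `g` disagree. -/
def errf (f g : (Fin n → Bool) → Bool) : ℝ :=
  ((Finset.univ.filter fun x => f x ≠ g x).card : ℝ) / 2 ^ n

/-- Error of the `f`-completion of a bare tree with respect to `f`. -/
def completionErr (f : (Fin n → Bool) → Bool) (T : BareTree n) : ℝ :=
  errf f (completion f T).eval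

/-- Score of the leaf with path `π`: `2^{-|ℓ|} · max_i Inf_i(f_ℓ)`. -/
def leafScore (f : (Fin n → Bool) → Bool) (π : List (Fin n × Bool)) : ℝ :=
  ((1 : ℝ) / 2) ^ π.length * ⨆ i : Fin n, influence (restrictList f π) i

/-- `i` is a most influential variable of `g`. -/
def IsMaxInfl (g : (Fin n → Bool) → Bool) (i : Fin n) : Prop :=
  ∀ j : Fin n, influence g j ≤ influence g i

/-- One step of BuildTopDownDT: replace a maximum-score leaf by a query to a most
influential variable of the corresponding restriction of `f`. -/
def SplitStep (f : (Fin n → Bool) → Bool) (T T' : BareTree n) : Prop :=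
  ∃ π ∈ T.leafPaths, ∃ i : Fin n,
    (∀ π' ∈ T.leafPaths, leafScore f π' ≤ leafScore f π) ∧
    IsMaxInfl (restrictList f π) i ∧
    T' = T.replaceLeaf π (.node i .leaf .leaf)

/-- A (partial) run of `BuildTopDownDT(f, ε)` of length `m`, under an arbitrary
tie-breaking rule: it starts from the single unlabeled leaf and, as long as the
`f`-completion is not an `ε`-approximation of `f`, performs a valid split. -/
def IsRun (f : (Fin n → Bool) → Bool) (ε : ℝ) (m : ℕ) (g : ℕ → BareTree n) : Prop :=
  g 0 = BareTree.leaf ∧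
  ∀ j < m, ε < completionErr f (g j) ∧ SplitStep f (g j) (g (j + 1))

/-- Monotonicity of a Boolean function (with `false ≤ true`). -/
def MonotoneBF (f : (Fin n → Bool) → Bool) : Prop :=
  ∀ x y : Fin n → Bool, (∀ i, x i ≤ y i) → f x ≤ f y

/-- Cost of a bare tree relative to `f`:  `Σ_ℓ 2^{-|ℓ|} · Inf(f_ℓ)`. -/
def costf (f : (Fin n → Bool) → Bool) (T : BareTree n) : ℝ :=
  (T.leafPaths.map fun π =>
    ((1 : ℝ) / 2) ^ π.length * totalInfluence (restrictList f π)).sum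

/-- Variance of a Boolean function: `4 · Pr[f = −1] · Pr[f = +1]`. -/
def varf (f : (Fin n → Bool) → Bool) : ℝ :=
  4 * (((Finset.univ.filter fun x => f x = false).card : ℝ) / 2 ^ n) *
      (((Finset.univ.filter fun x => f x = true).card : ℝ) / 2 ^ n)

/-- Expectation `E[f(x)]` of a ±1-valued Boolean function over a uniform input. -/
def expVal (f : (Fin n → Bool) → Bool) : ℝ :=
  (∑ x : Fin n → Bool, if f x then (1 : ℝ) else -1) / 2 ^ n

end TopDownDT

open TopDownDT

/-- The function `f_h` on the `3h+1` variables
`z` (index `0`), `x₁⁽ʲ⁾, x₂⁽ʲ⁾, y⁽ʲ⁾` (indices `3j-2, 3j-1, 3j` for `1 ≤ j ≤ h`):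
`f_0(z) = z`, and `f_{h}(x,y,z) = y⁽ʰ⁾` if `x₁⁽ʰ⁾ ∨ x₂⁽ʰ⁾`, else `f_{h-1}(x,y,z)`.
(`true` codes +1, `false` codes −1.) -/
def chainF : ℕ → (ℕ → Bool) → Bool
  | 0, x => x 0
  | h + 1, x => if x (3 * h + 1) || x (3 * h + 2) then x (3 * h + 3) else chainF h x

/-- `f_h` as a function on the cube `{0,1}^{3h+1}`. -/
def chainFun (h : ℕ) : (Fin (3 * h + 1) → Bool) → Bool :=
  fun x => chainF h fun i => if hi : i < 3 * h + 1 then x ⟨i, hi⟩ else false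

namespace TopDownDT

/-- The number of inputs at which `g` is sensitive to coordinate `i`. -/
def sensCount (g : (Fin n → Bool) → Bool) (i : Fin n) : ℕ :=
  (Finset.univ.filter fun x : Fin n → Bool => g x ≠ g (Function.update x i (!x i))).card

/-- The restriction of `g` to the subcube where coordinate `i` equals `b`. -/
def restrictVar (g : (Fin n → Bool) → Bool) (i : Fin n) (b : Bool) : (Fin n → Bool) → Bool :=
  fun x => g (Function.update x i b)

/-- `g` does not depend on coordinate `i`. -/
def IndepOf (g : (Fin n → Bool) → Bool) (i : Fin n) : Prop :=
  ∀ x b, g (Function.update x i b) = g x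

/-- Every internal node of the bare tree queries a most influential variable of the
restriction of `g` to that node. -/
def Greedy : ((Fin n → Bool) → Bool) → BareTree n → Prop
  | _, .leaf => True
  | g, .node i t0 t1 =>
      IsMaxInfl g i ∧ Greedy (restrictVar g i false) t0 ∧ Greedy (restrictVar g i true) t1

/-- The restriction of `g` to every leaf reached through relevant queries is constant. -/
def Exact : ((Fin n → Bool) → Bool) → BareTree n → Prop
  | g, .leaf => ∃ b, ∀ x, g x = b
  | g, .node i t0 t1 =>
      0 < sensCount g i → Exact (restrictVar g i false) t0 ∧ Exact (restrictVar g i true) t1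

theorem IsMaxInfl.sensCount_le {g : (Fin n → Bool) → Bool} {i : Fin n} (hi : IsMaxInfl g i)
    (j : Fin n) : sensCount g j ≤ sensCount g i := by
  have h := hi j
  unfold influence at h
  rw [div_le_div_iff_of_pos_right (by positivity)] at h
  unfold sensCount
  exact_mod_cast h

theorem restrictList_cons (g : (Fin n → Bool) → Bool) (i : Fin n) (b : Bool)
    (π : List (Fin n × Bool)) :
    restrictList g ((i, b) :: π) = restrictList (restrictVar g i b) π := by
  funext x
  unfold restrictList restrictVar
  congr 1
  funext k
  by_cases hk : i = k
  · subst hk; simp [override]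
  · simp [override, hk, Function.update_of_ne (Ne.symm hk)]

theorem override_append_singleton (π : List (Fin n × Bool)) (i : Fin n) (b : Bool)
    (x : Fin n → Bool) :
    override (π ++ [(i, b)]) x = override π (Function.update x i b) := by
  funext k
  unfold override
  rw [List.find?_append]
  cases hf : π.find? (fun p => decide (p.1 = k)) with
  | some p => simp
  | none =>
    by_cases hk : i = k
    · subst hk; simp
    · simp [hk, Function.update_of_ne (Ne.symm hk)]

theorem restrictList_append_singleton (g : (Fin n → Bool) → Bool) (i : Fin n) (b : Bool)
    (π : List (Fin n × Bool)) :
    restrictList g (π ++ [(i, b)]) = restrictVar (restrictList g π) i b := by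
  funext x
  simp [restrictList, restrictVar, override_append_singleton]

theorem Greedy.replaceLeaf {T : BareTree n} {i : Fin n} :
    ∀ {g : (Fin n → Bool) → Bool} {π : List (Fin n × Bool)}, Greedy g T → π ∈ T.leafPaths →
      IsMaxInfl (restrictList g π) i → Greedy g (T.replaceLeaf π (.node i .leaf .leaf)) := by
  induction T with
  | leaf =>
    intro g π _ hπ hi
    obtain rfl : π = [] := by simpa [BareTree.leafPaths] using hπ
    exact ⟨hi, trivial, trivial⟩
  | node k t0 t1 ih0 ih1 =>
    intro g π hg hπ hi
    obtain ⟨hk, h0, h1⟩ := hg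
    simp only [BareTree.leafPaths, List.mem_append, List.mem_map] at hπ
    rcases hπ with ⟨p, hp, rfl⟩ | ⟨p, hp, rfl⟩
    · rw [restrictList_cons] at hi
      exact ⟨hk, ih0 h0 hp hi, h1⟩
    · rw [restrictList_cons] at hi
      exact ⟨hk, h0, ih1 h1 hp hi⟩

theorem IsRun.greedy {f : (Fin n → Bool) → Bool} {ε : ℝ} {m : ℕ} {g : ℕ → BareTree n}
    (hg : IsRun f ε m g) : ∀ j ≤ m, Greedy f (g j) := by
  intro j
  induction j with
  | zero => intro _; rw [hg.1]; trivial
  | succ j ih =>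
    intro hj
    obtain ⟨-, π, hπ, i, -, hi, hT⟩ := hg.2 j hj
    rw [hT]
    exact (ih (by omega)).replaceLeaf hπ hi

theorem exact_of_completionAux {f : (Fin n → Bool) → Bool} {T : BareTree n} :
    ∀ {π : List (Fin n × Bool)},
      (∀ x, (completionAux f T π).eval (override π x) = restrictList f π x) →
      Exact (restrictList f π) T := by
  induction T with
  | leaf =>
    intro π h
    exact ⟨_, fun x => (h x).symm⟩
  | node i t0 t1 ih0 ih1 =>
    intro π h hs
    have hfree : ∀ (x : Fin n → Bool) (b : Bool), override π (Function.update x i b) i = b := by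
      obtain ⟨x, hx⟩ := Finset.card_pos.mp hs
      simp only [Finset.mem_filter, Finset.mem_univ, true_and] at hx
      cases hf : π.find? (fun p => decide (p.1 = i)) with
      | none => intro x b; simp [override, hf]
      | some p =>
        refine absurd ?_ hx
        unfold restrictList
        congr 1
        funext k
        by_cases hk : k = i
        · subst hk; simp [override, hf]
        · simp [override, Function.update_of_ne hk]
    rw [← restrictList_append_singleton, ← restrictList_append_singleton]
    constructor
    · refine ih0 fun x => ?_
      have := h (Function.update x i false)
      simp only [completionAux, DecTree.eval, hfree] at this
      rw [override_append_singleton]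
      simpa [restrictList, override_append_singleton] using this
    · refine ih1 fun x => ?_
      have := h (Function.update x i true)
      simp only [completionAux, DecTree.eval, hfree] at this
      rw [override_append_singleton]
      simpa [restrictList, override_append_singleton] using this

theorem exact_of_completionErr_le_zero {f : (Fin n → Bool) → Bool} {T : BareTree n}
    (h : completionErr f T ≤ 0) : Exact f T := by
  have hcard : (Finset.univ.filter fun x => f x ≠ (completion f T).eval x).card = 0 := by
    unfold completionErr errf at h
    by_contra hne
    have : (0 : ℝ) < (Finset.univ.filter fun x => f x ≠ (completion f T).eval x).card := by
      exact_mod_cast Nat.pos_of_ne_zero hne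
    have : (0 : ℝ) < (Finset.univ.filter fun x => f x ≠ (completion f T).eval x).card / 2 ^ n := by
      positivity
    linarith
  rw [Finset.card_eq_zero, Finset.filter_eq_empty_iff] at hcard
  refine exact_of_completionAux (π := []) fun x => ?_
  have := hcard (Finset.mem_univ x)
  push Not at this
  exact this.symm

theorem BareTree.size_pos (T : BareTree n) : 1 ≤ T.size := by
  induction T with
  | leaf => simp [BareTree.size]
  | node i t0 t1 h0 h1 => simp only [BareTree.size]; omega

theorem Exact.two_le_size {g : (Fin n → Bool) → Bool} {T : BareTree n} (hT : Exact g T)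
    {x y : Fin n → Bool} (hxy : g x ≠ g y) : 2 ≤ T.size := by
  cases T with
  | leaf => obtain ⟨b, hb⟩ := hT; simp [hb] at hxy
  | node i t0 t1 =>
    have := t0.size_pos
    have := t1.size_pos
    simp only [BareTree.size]; omega

/-- A tree exact for a non-constant function has a root, which is maximal for `sensCount`. -/
theorem exists_root {g : (Fin n → Bool) → Bool} {T : BareTree n} (hG : Greedy g T)
    (hE : Exact g T) {j : Fin n} (hj : 0 < sensCount g j) :
    ∃ i t0 t1, T = .node i t0 t1 ∧ (∀ k, sensCount g k ≤ sensCount g i) ∧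
      ∀ b, Greedy (restrictVar g i b) (if b then t1 else t0) ∧
        Exact (restrictVar g i b) (if b then t1 else t0) := by
  cases T with
  | leaf =>
    obtain ⟨b, hb⟩ := hE
    simp [sensCount, hb] at hj
  | node i t0 t1 =>
    obtain ⟨hi, h0, h1⟩ := hG
    obtain ⟨e0, e1⟩ := hE (hj.trans_le (hi.sensCount_le j))
    refine ⟨i, t0, t1, rfl, hi.sensCount_le, fun b => ?_⟩
    cases b
    · exact ⟨by simpa using h0, by simpa using e0⟩
    · exact ⟨by simpa using h1, by simpa using e1⟩

/-- Fixing a coordinate that a predicate ignores halves the number of its solutions. -/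
theorem two_mul_card_filter_and (i : Fin n) (b : Bool) (P : (Fin n → Bool) → Prop)
    [DecidablePred P] (hP : ∀ x c, P (Function.update x i c) ↔ P x) :
    2 * (Finset.univ.filter fun x : Fin n → Bool => x i = b ∧ P x).card =
      (Finset.univ.filter P).card := by
  have hsplit := Finset.card_filter_add_card_filter_not (s := Finset.univ.filter P)
    (fun x : Fin n → Bool => x i = b)
  have hflip : ((Finset.univ.filter P).filter fun x : Fin n → Bool => ¬ x i = b).card =
      ((Finset.univ.filter P).filter fun x : Fin n → Bool => x i = b).card := by
    refine Finset.card_nbij' (fun x => Function.update x i (!x i))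
      (fun x => Function.update x i (!x i)) ?_ ?_ ?_ ?_
    · intro x hx; simp [hP] at hx ⊢; exact ⟨hx.1, Bool.eq_not.mpr hx.2⟩
    · intro x hx; simp [hP] at hx ⊢; simpa using hx
    · intro x _; simp
    · intro x _; simp
  have heq : (Finset.univ.filter P).filter (fun x : Fin n → Bool => x i = b) =
      Finset.univ.filter fun x : Fin n → Bool => x i = b ∧ P x := by
    ext x; simp [and_comm]
  rw [hflip, heq] at hsplit
  omega

/-- Return `x y` when `x p ∨ x q` holds, and `K x` otherwise. -/
def muxVar (p q y : Fin n) (K : (Fin n → Bool) → Bool) : (Fin n → Bool) → Bool :=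
  fun x => if x p || x q then x y else K x

/-- Return `b` when `x p ∨ x q` holds, and `K x` otherwise. -/
def muxConst (p q : Fin n) (b : Bool) (K : (Fin n → Bool) → Bool) : (Fin n → Bool) → Bool :=
  fun x => if x p || x q then b else K x

/-- Return `b` when `x q` holds, and `K x` otherwise. -/
def muxOne (q : Fin n) (b : Bool) (K : (Fin n → Bool) → Bool) : (Fin n → Bool) → Bool :=
  fun x => if x q then b else K x

theorem sensCount_muxVar_lt {p q y j : Fin n} (K : (Fin n → Bool) → Bool) (hpq : p ≠ q)
    (hpy : p ≠ y) (hqy : q ≠ y) (hj : j ≠ y) :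
    sensCount (muxVar p q y K) j < sensCount (muxVar p q y K) y := by
  obtain ⟨c, hc, hcj⟩ : ∃ c, (c = p ∨ c = q) ∧ c ≠ j := by
    by_cases h : q = j
    · exact ⟨p, Or.inl rfl, h ▸ hpq⟩
    · exact ⟨q, Or.inr rfl, h⟩
  have hle : sensCount (muxVar p q y K) j ≤
      (Finset.univ.filter fun x : Fin n → Bool => x c = false ∧ True).card := by
    refine Finset.card_le_card fun x hx => ?_
    simp only [Finset.mem_filter, Finset.mem_univ, true_and, and_true] at hx ⊢
    by_contra hxc
    rw [Bool.not_eq_false] at hxc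
    apply hx
    rcases hc with rfl | rfl <;>
      simp [muxVar, Function.update_of_ne hcj, Function.update_of_ne hj.symm, hxc]
  have hge : (Finset.univ.filter fun x : Fin n → Bool => x p || x q).card ≤
      sensCount (muxVar p q y K) y := by
    refine Finset.card_le_card fun x hx => ?_
    simp only [Finset.mem_filter, Finset.mem_univ, true_and] at hx ⊢
    simp [muxVar, Function.update_of_ne hpy, Function.update_of_ne hqy] at hx ⊢
    simp [hx]
  have hlt : (Finset.univ.filter fun x : Fin n → Bool => x c = true ∧ True).card <
      (Finset.univ.filter fun x : Fin n → Bool => x p || x q).card := by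
    refine Finset.card_lt_card (Finset.ssubset_iff_of_subset ?_ |>.mpr
      ⟨Function.update (fun _ => true) c false, ?_, by simp⟩)
    · intro x hx
      simp only [Finset.mem_filter, Finset.mem_univ, true_and, and_true] at hx ⊢
      rcases hc with rfl | rfl <;> simp [hx]
    · rcases hc with rfl | rfl <;> simp [Function.update_of_ne hpq, Function.update_of_ne hpq.symm]
  have h1 := two_mul_card_filter_and c true (fun _ => True) (by simp)
  have h2 := two_mul_card_filter_and c false (fun _ => True) (by simp)
  omega

theorem restrictVar_muxVar {p q y : Fin n} {K : (Fin n → Bool) → Bool} (hpy : p ≠ y)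
    (hqy : q ≠ y) (hK : IndepOf K y) (b : Bool) :
    restrictVar (muxVar p q y K) y b = muxConst p q b K := by
  funext x
  simp [restrictVar, muxVar, muxConst, Function.update_of_ne hpy, Function.update_of_ne hqy, hK x b]

/-- Any greedy exact tree for `muxVar p q y K` queries `y` first. -/
theorem two_mul_le_size_muxVar {p q y : Fin n} {K : (Fin n → Bool) → Bool} (hpq : p ≠ q)
    (hpy : p ≠ y) (hqy : q ≠ y) (hK : IndepOf K y) {L : ℕ}
    (hL : ∀ (b : Bool) (T : BareTree n), Greedy (muxConst p q b K) T →
      Exact (muxConst p q b K) T → L ≤ T.size)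
    {T : BareTree n} (hG : Greedy (muxVar p q y K) T) (hE : Exact (muxVar p q y K) T) :
    2 * L ≤ T.size := by
  have hlt := fun {j : Fin n} => sensCount_muxVar_lt (j := j) K hpq hpy hqy
  obtain ⟨i, t0, t1, rfl, hi, ht⟩ := exists_root hG hE ((Nat.zero_le _).trans_lt (hlt hpy))
  obtain rfl : i = y := by
    by_contra hne
    exact absurd (hi y) (not_le.mpr (hlt hne))
  simp only [restrictVar_muxVar hpy hqy hK] at ht
  have h0 := hL false _ (ht false).1 (ht false).2
  have h1 := hL true _ (ht true).1 (ht true).2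
  simp only [BareTree.size]
  simp at h0 h1
  omega

theorem two_le_size_muxConst {p q : Fin n} {b : Bool} {K : (Fin n → Bool) → Bool}
    (hp : IndepOf K p) (hq : IndepOf K q) (hK : ∃ x, K x ≠ b) {T : BareTree n}
    (hE : Exact (muxConst p q b K) T) : 2 ≤ T.size := by
  obtain ⟨x, hx⟩ := hK
  refine hE.two_le_size (x := Function.update (Function.update x p false) q false)
    (y := fun _ => true) ?_
  have : Function.update (Function.update x p false) q false p = false := by
    by_cases h : p = q
    · subst h; simp
    · simp [Function.update_of_ne h]
  simp [muxConst, this, hp x, hq _ false, hx]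

theorem sensCount_lt_of_exists {K : (Fin n → Bool) → Bool} {j : Fin n}
    (h : ∃ x, K x = K (Function.update x j (!x j))) :
    sensCount K j < (Finset.univ : Finset (Fin n → Bool)).card := by
  obtain ⟨x, hx⟩ := h
  refine Finset.card_lt_card (Finset.filter_ssubset.mpr ⟨x, Finset.mem_univ x, ?_⟩)
  simpa using hx

theorem IndepOf.sens_update_iff {K : (Fin n → Bool) → Bool} {q : Fin n} (hK : IndepOf K q)
    {j : Fin n} (hj : j ≠ q) (x : Fin n → Bool) (c : Bool) :
    K (Function.update x q c) ≠
        K (Function.update (Function.update x q c) j (!(Function.update x q c) j)) ↔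
      K x ≠ K (Function.update x j (!x j)) := by
  rw [hK, Function.update_comm hj.symm, hK, Function.update_of_ne hj]

theorem two_mul_sensCount_muxOne {q j : Fin n} {b : Bool} {K : (Fin n → Bool) → Bool}
    (hK : IndepOf K q) (hj : j ≠ q) :
    2 * sensCount (muxOne q b K) j = sensCount K j := by
  have h := two_mul_card_filter_and q false (fun x => K x ≠ K (Function.update x j (!x j)))
    (hK.sens_update_iff hj)
  unfold sensCount
  rw [← h]
  congr 2
  ext x
  cases hx : x q <;> simp [muxOne, Function.update_of_ne hj.symm, hx]

theorem sensCount_muxOne_self {q : Fin n} {b : Bool} {K : (Fin n → Bool) → Bool}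
    (hK : IndepOf K q) :
    sensCount (muxOne q b K) q = (Finset.univ.filter fun x : Fin n → Bool => K x ≠ b).card := by
  unfold sensCount
  congr 1
  ext x
  cases hx : x q <;> simp [muxOne, hx, hK x, ne_comm (a := b)]

theorem muxConst_eq_muxOne (p q : Fin n) (b : Bool) (K : (Fin n → Bool) → Bool) :
    muxConst p q b K = muxOne p b (muxOne q b K) := by
  funext x
  cases hp : x p <;> simp [muxConst, muxOne, hp]

theorem muxConst_comm (p q : Fin n) (b : Bool) (K : (Fin n → Bool) → Bool) :
    muxConst p q b K = muxConst q p b K := by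
  funext x
  simp [muxConst, or_comm]

theorem IndepOf.muxOne {p q : Fin n} {b : Bool} {K : (Fin n → Bool) → Bool} (hK : IndepOf K p)
    (hpq : p ≠ q) : IndepOf (muxOne q b K) p := by
  intro x c
  simp [TopDownDT.muxOne, Function.update_of_ne hpq.symm, hK x c]

theorem restrictVar_muxOne {q : Fin n} {b : Bool} {K : (Fin n → Bool) → Bool}
    (hK : IndepOf K q) : restrictVar (muxOne q b K) q false = K := by
  funext x
  simp [restrictVar, muxOne, hK x]

/-- `K` takes each value equally often. -/
def Balanced (K : (Fin n → Bool) → Bool) : Prop :=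
  ∀ b, 2 * (Finset.univ.filter fun x : Fin n → Bool => K x ≠ b).card =
    (Finset.univ : Finset (Fin n → Bool)).card

/-- Every coordinate has an input at which `K` is insensitive to it. -/
def NowhereFullySensitive (K : (Fin n → Bool) → Bool) : Prop :=
  ∀ j : Fin n, ∃ x, K x = K (Function.update x j (!x j))

theorem le_size_muxOne {q : Fin n} {b : Bool} {K : (Fin n → Bool) → Bool} (hK : IndepOf K q)
    (hbal : Balanced K) (hins : NowhereFullySensitive K) {L : ℕ}
    (hL : ∀ T : BareTree n, Greedy K T → Exact K T → L ≤ T.size)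
    {T : BareTree n} (hG : Greedy (muxOne q b K) T) (hE : Exact (muxOne q b K) T) :
    L ≤ T.size := by
  have hself := sensCount_muxOne_self (b := b) hK
  have hb := hbal b
  have hpos : 0 < (Finset.univ : Finset (Fin n → Bool)).card :=
    Finset.card_pos.mpr Finset.univ_nonempty
  obtain ⟨i, t0, t1, rfl, hi, ht⟩ := exists_root hG hE (j := q) (by omega)
  obtain rfl : i = q := by
    by_contra hne
    have h1 := hi q
    have h2 := two_mul_sensCount_muxOne (b := b) hK hne
    have h3 := sensCount_lt_of_exists (hins i)
    omega
  have h := ht false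
  rw [restrictVar_muxOne hK] at h
  have h0 := hL _ h.1 h.2
  simp only [BareTree.size]
  simp at h0
  omega

theorem le_size_muxConst {p q : Fin n} {b : Bool} {K : (Fin n → Bool) → Bool} (hpq : p ≠ q)
    (hp : IndepOf K p) (hq : IndepOf K q) (hbal : Balanced K) (hins : NowhereFullySensitive K)
    {L : ℕ} (hL : ∀ T : BareTree n, Greedy K T → Exact K T → L ≤ T.size)
    {T : BareTree n} (hG : Greedy (muxConst p q b K) T) (hE : Exact (muxConst p q b K) T) :
    L ≤ T.size := by
  have hpq' : muxConst p q b K = muxOne p b (muxOne q b K) := muxConst_eq_muxOne p q b K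
  have hqp' : muxConst p q b K = muxOne q b (muxOne p b K) := by
    rw [muxConst_comm, muxConst_eq_muxOne]
  have hself : 2 * sensCount (muxConst p q b K) q =
      (Finset.univ.filter fun x : Fin n → Bool => K x ≠ b).card := by
    rw [hpq', two_mul_sensCount_muxOne (hp.muxOne hpq) hpq.symm, sensCount_muxOne_self hq]
  have hb := hbal b
  have hpos : 0 < (Finset.univ : Finset (Fin n → Bool)).card :=
    Finset.card_pos.mpr Finset.univ_nonempty
  obtain ⟨i, t0, t1, rfl, hi, ht⟩ := exists_root hG hE (j := q) (by omega)
  have hroot : i = p ∨ i = q := by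
    by_contra! hne
    have h1 := hi q
    have h2 : 2 * sensCount (muxConst p q b K) i = sensCount (muxOne q b K) i := by
      rw [hpq', two_mul_sensCount_muxOne (hp.muxOne hpq) hne.1]
    have h3 := two_mul_sensCount_muxOne (b := b) hq hne.2
    have h4 := sensCount_lt_of_exists (hins i)
    omega
  have h := ht false
  have h0 : L ≤ t0.size := by
    rcases hroot with rfl | rfl
    · rw [hpq', restrictVar_muxOne (hp.muxOne hpq)] at h
      exact le_size_muxOne hq hbal hins hL (by simpa using h.1) (by simpa using h.2)
    · rw [hqp', restrictVar_muxOne (hq.muxOne hpq.symm)] at h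
      exact le_size_muxOne hp hbal hins hL (by simpa using h.1) (by simpa using h.2)
  simp only [BareTree.size]
  omega

end TopDownDT

/-- Extension of an input by `false` outside its index range. -/
def extendFalse {n : ℕ} (x : Fin n → Bool) : ℕ → Bool :=
  fun i => if hi : i < n then x ⟨i, hi⟩ else false

/-- `f_h` as a function on the cube `{0,1}^n`. -/
def chainOn (n h : ℕ) : (Fin n → Bool) → Bool :=
  fun x => chainF h (extendFalse x)

theorem chainF_congr {h : ℕ} {u v : ℕ → Bool} (huv : ∀ i < 3 * h + 1, u i = v i) :
    chainF h u = chainF h v := by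
  induction h with
  | zero => exact huv 0 (by omega)
  | succ h ih =>
    simp only [chainF]
    rw [huv (3 * h + 1) (by omega), huv (3 * h + 2) (by omega), huv (3 * h + 3) (by omega),
      ih fun i hi => huv i (by omega)]

theorem indepOf_chainOn {n h : ℕ} {i : Fin n} (hi : 3 * h + 1 ≤ i) : IndepOf (chainOn n h) i := by
  intro x b
  refine chainF_congr fun k hk => ?_
  unfold extendFalse
  split
  · rw [Function.update_of_ne]
    intro hki
    rw [← hki] at hi
    simp at hi
    omega
  · rfl

theorem chainOn_succ {n h : ℕ} (hn : 3 * h + 3 < n) :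
    chainOn n (h + 1) = muxVar ⟨3 * h + 1, by omega⟩ ⟨3 * h + 2, by omega⟩ ⟨3 * h + 3, hn⟩
      (chainOn n h) := by
  funext x
  have h1 : 3 * h + 1 < n := by omega
  have h2 : 3 * h + 2 < n := by omega
  simp [chainOn, chainF, muxVar, extendFalse, h1, h2, hn]

theorem chainF_flip (h : ℕ) {u v : ℕ → Bool}
    (huv : ∀ i < 3 * h + 1, v i = if i % 3 = 0 then !u i else u i) :
    chainF h v = !chainF h u := by
  induction h with
  | zero => simpa [chainF] using huv 0 (by omega)
  | succ h ih =>
    have e1 := huv (3 * h + 1) (by omega)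
    have e2 := huv (3 * h + 2) (by omega)
    have e3 := huv (3 * h + 3) (by omega)
    rw [if_neg (by omega)] at e1 e2
    rw [if_pos (by omega)] at e3
    simp only [chainF, e1, e2, e3, ih fun i hi => huv i (by omega)]
    split <;> rfl

theorem balanced_chainOn {n h : ℕ} (hn : 3 * h + 1 ≤ n) : Balanced (chainOn n h) := by
  intro b
  let σ : (Fin n → Bool) → Fin n → Bool := fun x i => if i.val % 3 = 0 then !x i else x i
  have hσ : ∀ x, chainOn n h (σ x) = !chainOn n h x := by
    intro x
    refine chainF_flip h fun i hi => ?_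
    have : i < n := by omega
    simp [extendFalse, this, σ]
  have hσσ : ∀ x, σ (σ x) = x := by
    intro x; funext i; simp only [σ]; split <;> simp
  have hsplit := Finset.card_filter_add_card_filter_not (s := (Finset.univ : Finset (Fin n → Bool)))
    (fun x => chainOn n h x ≠ b)
  have hflip : (Finset.univ.filter fun x : Fin n → Bool => ¬ chainOn n h x ≠ b).card =
      (Finset.univ.filter fun x : Fin n → Bool => chainOn n h x ≠ b).card := by
    refine Finset.card_nbij' σ σ ?_ ?_ (fun x _ => hσσ x) (fun x _ => hσσ x)
    · intro x hx; simpa [hσ] using hx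
    · intro x hx; simp [hσ] at hx ⊢; exact Bool.eq_not.mpr hx
  omega

theorem nowhereFullySensitive_chainOn {n h : ℕ} (hn : 3 * h + 3 < n) :
    NowhereFullySensitive (chainOn n (h + 1)) := by
  intro j
  rw [chainOn_succ hn]
  by_cases hj : j = ⟨3 * h + 3, hn⟩
  · subst hj
    refine ⟨fun _ => false, ?_⟩
    have := indepOf_chainOn (n := n) (h := h) (i := ⟨3 * h + 3, hn⟩) (by simp) (fun _ => false) true
    simp [muxVar, this]
  · refine ⟨fun _ => true, ?_⟩
    by_cases h1 : (⟨3 * h + 1, by omega⟩ : Fin n) = j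
    · subst h1; simp [muxVar]
    · simp [muxVar, Function.update_of_ne h1, Function.update_of_ne (Ne.symm hj)]

theorem exists_ne_of_balanced {n : ℕ} {K : (Fin n → Bool) → Bool} (hK : Balanced K) (b : Bool) :
    ∃ x, K x ≠ b := by
  have hpos : 0 < (Finset.univ : Finset (Fin n → Bool)).card :=
    Finset.card_pos.mpr Finset.univ_nonempty
  have hb := hK b
  obtain ⟨x, hx⟩ := Finset.card_pos.mp
    (show 0 < (Finset.univ.filter fun x : Fin n → Bool => K x ≠ b).card by omega)
  exact ⟨x, (Finset.mem_filter.mp hx).2⟩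

theorem two_pow_le_size_of_greedy_exact {n : ℕ} (h : ℕ) (hn : 3 * h + 1 ≤ n) (T : BareTree n)
    (hG : Greedy (chainOn n h) T) (hE : Exact (chainOn n h) T) : 2 ^ (h + 1) ≤ T.size := by
  induction h generalizing T with
  | zero =>
    obtain ⟨x, hx⟩ := exists_ne_of_balanced (balanced_chainOn hn) true
    obtain ⟨y, hy⟩ := exists_ne_of_balanced (balanced_chainOn hn) false
    refine hE.two_le_size (x := x) (y := y) fun hxy => ?_
    simp_all
  | succ h ih =>
    have hn' : 3 * h + 1 ≤ n := by omega
    have hy : 3 * h + 3 < n := by omega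
    have hbal := balanced_chainOn hn'
    rw [chainOn_succ hy] at hG hE
    rw [pow_succ']
    refine two_mul_le_size_muxVar (by simp) (by simp) (by simp) (indepOf_chainOn (by simp))
      (fun b T hG hE => ?_) hG hE
    cases h with
    | zero =>
      exact two_le_size_muxConst (indepOf_chainOn (by simp)) (indepOf_chainOn (by simp))
        (exists_ne_of_balanced hbal b) hE
    | succ h =>
      exact le_size_muxConst (by simp) (indepOf_chainOn (by simp)) (indepOf_chainOn (by simp)) hbal
        (nowhereFullySensitive_chainOn (by omega)) (ih hn') hG hE

theorem exists_decTree_chainOn {n : ℕ} (h : ℕ) (hn : 3 * h + 1 ≤ n) :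
    ∃ T : DecTree n, (∀ x, T.eval x = chainOn n h x) ∧ T.size = 4 * h + 2 := by
  induction h with
  | zero =>
    have h0 : 0 < n := by omega
    refine ⟨.node ⟨0, h0⟩ (.leaf false) (.leaf true), fun x => ?_, rfl⟩
    simp [DecTree.eval, chainOn, chainF, extendFalse, h0]
  | succ h ih =>
    obtain ⟨T, hT, hsize⟩ := ih (by omega)
    have hy : 3 * h + 3 < n := by omega
    let Y : DecTree n := .node ⟨3 * h + 3, hy⟩ (.leaf false) (.leaf true)
    refine ⟨.node ⟨3 * h + 1, by omega⟩ (.node ⟨3 * h + 2, by omega⟩ T Y) Y, fun x => ?_, ?_⟩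
    · rw [chainOn_succ hy]
      simp only [DecTree.eval, muxVar, hT, Y]
      cases x ⟨3 * h + 1, by omega⟩ <;> cases x ⟨3 * h + 2, by omega⟩ <;> simp
    · simp only [DecTree.size, hsize, Y]
      omega

/-- The optimal decision tree size of `f_h` is at most `4h + 2`,
yet `BuildTopDownDT(f_h, 0)` — regardless of how ties are broken — outputs a tree
of size at least `2^{h+1}`.  (A complete run of `BuildTopDownDT(f, 0)` is a run
whose final bare tree has an exact `f`-completion, i.e. error `≤ 0`.) -/
theorem chain_exact_separation (h : ℕ) (hh : 1 ≤ h) :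
    optSize (chainFun h) ≤ 4 * h + 2 ∧
    ∀ (m : ℕ) (g : ℕ → BareTree (3 * h + 1)),
      IsRun (chainFun h) 0 m g →
      completionErr (chainFun h) (g m) ≤ 0 →
      2 ^ (h + 1) ≤ (g m).size := by
  refine ⟨Nat.sInf_le (exists_decTree_chainOn h le_rfl), fun m g hrun herr => ?_⟩
  exact two_pow_le_size_of_greedy_exact h le_rfl (g m) (hrun.greedy m le_rfl)
    (exact_of_completionErr_le_zero herr)
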